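/- For a 3×3 unitary complex matrix U, the areas of all six unitarity triangles coincide; equivalently, the quantity |Im(U_{i j} · U_{k l} · conj(U_{i l}) · conj(U_{k j}))| is independent of the choice of row indices i ≠ k and column indices j ≠ l in {0,1,2}. -/

import Mathlib

open Matrix Complex

/-- If three complex numbers sum to zero, they are the sides of a triangle, and the area spanned
by two of its sides does not depend on the choice of the two sides. -/
theorem abs_im_mul_conj_eq_of_sum_eq_zero (a : Fin 3 → ℂ) (ha : ∑ m, a m = 0)
    {i k i' k' : Fin 3} (hik : i ≠ k) (hik' : i' ≠ k') :
    |(a i * (starRingEnd ℂ) (a k)).im| = |(a i' * (starRingEnd ℂ) (a k')).im| := by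
  have key : ∀ i k : Fin 3, i ≠ k →
      |(a i * (starRingEnd ℂ) (a k)).im| = |(a 0 * (starRingEnd ℂ) (a 1)).im| := by
    have h2 : a 2 = -a 0 - a 1 := by
      rw [Fin.sum_univ_three] at ha
      linear_combination ha
    intro i k hik
    rw [abs_eq_abs]
    fin_cases i <;> fin_cases k <;> simp [h2] at hik ⊢ <;>
      first
        | (left; ring1)
        | (right; ring1)
  rw [key i k hik, key i' k' hik']

theorem unitarity_triangle_areas_equal (U : Matrix (Fin 3) (Fin 3) ℂ)
    (hU : U ∈ Matrix.unitaryGroup (Fin 3) ℂ)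
    (i k j l i' k' j' l' : Fin 3)
    (hik : i ≠ k) (hjl : j ≠ l) (hik' : i' ≠ k') (hjl' : j' ≠ l') :
    |(U i j * U k l * (starRingEnd ℂ) (U i l) * (starRingEnd ℂ) (U k j)).im| =
    |(U i' j' * U k' l' * (starRingEnd ℂ) (U i' l') * (starRingEnd ℂ) (U k' j')).im| := by
  have hcol : ∑ m, U m j * (starRingEnd ℂ) (U m l) = 0 := by
    have h := congrFun₂ (Matrix.mem_unitaryGroup_iff'.mp hU) l j
    simpa [Matrix.mul_apply, Matrix.star_apply, Matrix.one_apply_ne hjl.symm, mul_comm] using h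
  have hrow : ∑ m, U i' m * (starRingEnd ℂ) (U k' m) = 0 := by
    have h := congrFun₂ (Matrix.mem_unitaryGroup_iff.mp hU) i' k'
    simpa [Matrix.mul_apply, Matrix.star_apply, Matrix.one_apply_ne hik'] using h
  have h₁ := abs_im_mul_conj_eq_of_sum_eq_zero _ hcol hik hik'
  have h₂ := abs_im_mul_conj_eq_of_sum_eq_zero _ hrow hjl hjl'
  simp only [map_mul, Complex.conj_conj] at h₁ h₂
  calc _ = _ := by congr 2; ring
    _ = _ := h₁
    _ = _ := by congr 2; ring
    _ = _ := h₂
    _ = _ := by congr 2; ring
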